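/- arXiv:2502.02690 — 4 statements merged into one kernel-verified Lean document; each statement's English description precedes it below -/
import Mathlib

section
/- Let n ≥ 1 and let F : ℝⁿ → ℝ be twice continuously differentiable. If for every z ∈ ℝⁿ and all indices i ≠ j the mixed partial derivative ∂²F/∂z_i∂z_j(z) equals 0, then there exist twice continuously differentiable functions f_1, …, f_n : ℝ → ℝ such that F(z) = ∑_{i=1}^n f_i(z_i) for all z ∈ ℝⁿ. -/
theorem Differentiable.apply_add_eq_of_fderiv_apply_eq_zero {E : Type*} [NormedAddCommGroup E]
    [NormedSpace ℝ E] {g : E → ℝ} (hg : Differentiable ℝ g) {v : E}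
    (hv : ∀ x, fderiv ℝ g x v = 0) (x : E) : g (x + v) = g x := by
  have key (t : ℝ) : HasDerivAt (fun t : ℝ => g (x + t • v)) 0 t := by
    have h₁ : HasDerivAt (fun t : ℝ => x + t • v) v t := by
      simpa using ((hasDerivAt_id t).smul_const v).const_add x
    simpa only [hv, Function.comp_def] using
      (hg (x + t • v)).hasFDerivAt.comp_hasDerivAt t h₁
  have := is_const_of_deriv_eq_zero (fun t => (key t).differentiableAt)
    (fun t => (key t).deriv) 1 0
  simpa using this

/-- A function on a finite product of lines whose partial derivatives in all directions but `j`
vanish depends only on the `j`-th coordinate. -/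
theorem Differentiable.eq_of_fderiv_single_eq_zero {ι : Type*} [Fintype ι] [DecidableEq ι]
    {g : (ι → ℝ) → ℝ} (hg : Differentiable ℝ g) {j : ι}
    (h : ∀ x i, i ≠ j → fderiv ℝ g x (Pi.single i 1) = 0) {z w : ι → ℝ} (hzw : z j = w j) :
    g z = g w := by
  have hv (x : ι → ℝ) : fderiv ℝ g x (z - w) = 0 := by
    rw [pi_eq_sum_univ' (z - w), map_sum]
    refine Finset.sum_eq_zero fun i _ => ?_
    rw [map_smul]
    rcases eq_or_ne i j with rfl | hij
    · simp [hzw]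
    · rw [h x i hij, smul_zero]
  simpa using hg.apply_add_eq_of_fderiv_apply_eq_zero hv w

/-- If a C² function `F : ℝⁿ → ℝ` has all mixed second partial derivatives
`∂²F/∂z_i∂z_j` (for `i ≠ j`) identically zero, then `F` decomposes as a sum
of C² functions of the individual coordinates. -/
theorem additive_decomposition_of_vanishing_cross_derivatives
    (n : ℕ) (hn : 1 ≤ n) (F : (Fin n → ℝ) → ℝ)
    (hF : ContDiff ℝ 2 F)
    (hmix : ∀ z : Fin n → ℝ, ∀ i j : Fin n, i ≠ j →
      fderiv ℝ (fun y => fderiv ℝ F y (Pi.single j 1)) z (Pi.single i 1) = 0) :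
    ∃ f : Fin n → (ℝ → ℝ), (∀ i, ContDiff ℝ 2 (f i)) ∧
      ∀ z : Fin n → ℝ, F z = ∑ i, f i (z i) := by
  have hF₁ : Differentiable ℝ F := hF.differentiable (by norm_num)
  let L (i : Fin n) : (Fin n → ℝ) →L[ℝ] (Fin n → ℝ) :=
    (ContinuousLinearMap.single ℝ (fun _ : Fin n => ℝ) i).comp (ContinuousLinearMap.proj i)
  have hL (i : Fin n) (z : Fin n → ℝ) : L i z = Pi.single i (z i) := rfl
  have hpartial (j : Fin n) (z w : Fin n → ℝ) (hzw : z j = w j) :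
      fderiv ℝ F z (Pi.single j 1) = fderiv ℝ F w (Pi.single j 1) := by
    have hd : Differentiable ℝ fun y => fderiv ℝ F y (Pi.single j 1) :=
      ((hF.fderiv_right (m := 1) (by norm_num)).differentiable (by norm_num)).clm_apply
        (differentiable_const _)
    exact hd.eq_of_fderiv_single_eq_zero (fun x i hij => hmix x i j hij) hzw
  have hG (z : Fin n → ℝ) : HasFDerivAt (fun y => F y - ∑ i, F (L i y))
      (fderiv ℝ F z - ∑ i, (fderiv ℝ F (L i z)).comp (L i)) z :=
    (hF₁ z).hasFDerivAt.sub <| HasFDerivAt.fun_sum fun i _ =>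
      (hF₁ (L i z)).hasFDerivAt.comp z (L i).hasFDerivAt
  have hG₀ (z : Fin n → ℝ) : fderiv ℝ F z - ∑ i, (fderiv ℝ F (L i z)).comp (L i) = 0 := by
    refine ContinuousLinearMap.coe_injective (LinearMap.pi_ext' fun j => LinearMap.ext_ring ?_)
    have hsum : ∑ i, fderiv ℝ F (L i z) (L i (Pi.single j 1)) =
        fderiv ℝ F (L j z) (Pi.single j 1) := by
      rw [Finset.sum_eq_single j]
      · simp [hL]
      · intro i _ hij
        simp [hL, hij]
      · simp
    have := hpartial j z (L j z) (by simp [hL])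
    simp [hsum, this]
  have hconst (z : Fin n → ℝ) := is_const_of_fderiv_eq_zero (𝕜 := ℝ)
    (fun z => (hG z).differentiableAt) (fun z => (hG z).fderiv.trans (hG₀ z)) z 0
  have hn₀ : (n : ℝ) ≠ 0 := by positivity
  refine ⟨fun i t => F (Pi.single i t) + (F 0 - n * F 0) / n, fun i => ?_, fun z => ?_⟩
  · exact (hF.comp (ContinuousLinearMap.single ℝ (fun _ : Fin n => ℝ) i).contDiff).add
      contDiff_const
  · have h := hconst z
    simp only [hL] at h
    simp only [Finset.sum_add_distrib, Finset.sum_const, Finset.card_univ, Fintype.card_fin,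
      nsmul_eq_mul, mul_div_cancel₀ _ hn₀]
    field_simp
    simp at h
    linarith
end

section
/- Let Z be a connected topological space and let A : Z → Mat_{n×n}(ℝ) be continuous such that for every z ∈ Z the matrix A(z) is invertible and is a generalized permutation matrix. Then there exists a single permutation π of {1, …, n} such that for all z ∈ Z and all indices k, i: A(z)_{k,i} ≠ 0 if and only if i = π(k). -/
/-- If each `f z` has exactly one nonzero entry, the nonvanishing locus of every entry of a
continuous family `f` is clopen. -/
theorem isClopen_setOf_apply_ne_zero {Z ι R : Type*} [TopologicalSpace Z] [TopologicalSpace R]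
    [T1Space R] [Zero R] {f : Z → ι → R} (hf : Continuous f)
    (hunique : ∀ z, ∃! i, f z i ≠ 0) (i : ι) : IsClopen {z | f z i ≠ 0} := by
  have hopen (j : ι) : IsOpen {z | f z j ≠ 0} :=
    isOpen_compl_singleton.preimage ((continuous_apply j).comp hf)
  refine ⟨⟨?_⟩, hopen i⟩
  have hcompl : {z | f z i ≠ 0}ᶜ = ⋃ j ∈ {j | j ≠ i}, {z | f z j ≠ 0} := by
    ext z
    simp only [Set.mem_compl_iff, Set.mem_ofPred_eq, Set.mem_iUnion, exists_prop]
    constructor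
    · intro hi
      obtain ⟨j, hj, -⟩ := hunique z
      exact ⟨j, fun hji => hi (hji ▸ hj), hj⟩
    · rintro ⟨j, hji, hj⟩ hi
      exact hji ((hunique z).unique hj hi)
  rw [hcompl]
  exact isOpen_biUnion fun j _ => hopen j

/-- If `A : Z → Matrix (Fin n) (Fin n) ℝ` is continuous on a connected space `Z`, and
`A z` is invertible and a generalized permutation matrix (exactly one nonzero entry in
each row and each column) for every `z`, then there is a single permutation `π` such
that for all `z`, `A z k i ≠ 0 ↔ i = π k`. -/
theorem continuous_generalized_permutation_has_fixed_pattern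
    (n : ℕ) (Z : Type*) [TopologicalSpace Z] [ConnectedSpace Z]
    (A : Z → Matrix (Fin n) (Fin n) ℝ) (hcont : Continuous A)
    (hinv : ∀ z, IsUnit (A z).det)
    (hgp : ∀ z, (∀ k : Fin n, ∃! i : Fin n, A z k i ≠ 0) ∧
                (∀ i : Fin n, ∃! k : Fin n, A z k i ≠ 0)) :
    ∃ π : Equiv.Perm (Fin n), ∀ (z : Z) (k i : Fin n), A z k i ≠ 0 ↔ i = π k := by
  obtain ⟨z₀⟩ : Nonempty Z := inferInstance
  choose σ hσ _ using (hgp z₀).1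
  have hne (z : Z) (k : Fin n) : A z k (σ k) ≠ 0 := by
    have huniv := (isClopen_setOf_apply_ne_zero ((continuous_apply k).comp hcont)
      (fun z => (hgp z).1 k) (σ k)).eq_univ ⟨z₀, hσ k⟩
    exact Set.eq_univ_iff_forall.mp huniv z
  have hinj : Function.Injective σ := fun k l hkl =>
    ((hgp z₀).2 (σ k)).unique (hσ k) (hkl ▸ hσ l)
  refine ⟨Equiv.ofBijective σ (Finite.injective_iff_bijective.mp hinj), fun z k i => ?_⟩
  rw [Equiv.ofBijective_apply]
  exact ⟨fun hi => ((hgp z).1 k).unique hi (hne z k), fun hi => hi ▸ hne z k⟩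
end

section
/- Let h : ℝⁿ → ℝⁿ be a C¹ diffeomorphism such that at every point ẑ ∈ ℝⁿ the Jacobian matrix Dh(ẑ) is a generalized permutation matrix. Then there exist a permutation π of {1, …, n} and C¹ diffeomorphisms T_1, …, T_n : ℝ → ℝ such that h(ẑ)_k = T_k(ẑ_{π(k)}) for all ẑ ∈ ℝⁿ and all k ∈ {1, …, n}. -/
/-- A linear form on `ℝ^ι` that vanishes on all basis vectors but the `i`-th vanishes on every
vector whose `i`-th coordinate is zero. -/
theorem ContinuousLinearMap.pi_apply_eq_zero {ι : Type*} [Fintype ι] [DecidableEq ι]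
    (L : (ι → ℝ) →L[ℝ] ℝ) {i : ι} (hL : ∀ j, j ≠ i → L (Pi.single j 1) = 0)
    {u : ι → ℝ} (hu : u i = 0) : L u = 0 := by
  rw [pi_eq_sum_univ' u, map_sum]
  refine Finset.sum_eq_zero fun j _ => ?_
  rw [map_smul]
  by_cases hj : j = i
  · subst hj
    simp [hu]
  · rw [hL j hj, smul_zero]

/-- A differentiable function on `ℝ^ι` whose partial derivatives other than the `i`-th vanish
depends only on the `i`-th coordinate. -/
theorem eq_of_partial_fderiv_eq_zero {ι : Type*} [Fintype ι] [DecidableEq ι]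
    {f : (ι → ℝ) → ℝ} (hf : Differentiable ℝ f) {i : ι}
    (hfi : ∀ z j, j ≠ i → fderiv ℝ f z (Pi.single j 1) = 0)
    {z w : ι → ℝ} (hzw : z i = w i) : f z = f w := by
  have hline : ∀ t : ℝ, HasDerivAt (fun t : ℝ => f (z + t • (w - z))) 0 t := by
    intro t
    have hinner : HasDerivAt (fun t : ℝ => z + t • (w - z)) (w - z) t := by
      simpa using ((hasDerivAt_id t).smul_const (w - z)).const_add z
    have hcomp := (hf (z + t • (w - z))).hasFDerivAt.comp_hasDerivAt t hinner
    rwa [ContinuousLinearMap.pi_apply_eq_zero _ (hfi _) (by simp [hzw])] at hcomp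
  have hconst := is_const_of_deriv_eq_zero (fun t => (hline t).differentiableAt)
    (fun t => (hline t).deriv) 0 1
  simpa using hconst

/-- If exactly one of finitely many continuous functions on a preconnected space is nonzero at
each point, then it is the same one everywhere. -/
theorem exists_forall_ne_zero_iff_of_existsUnique {X ι : Type*} [TopologicalSpace X]
    [PreconnectedSpace X] [Nonempty X] {f : ι → X → ℝ} (hf : ∀ i, Continuous (f i))
    (hu : ∀ x, ∃! i, f i x ≠ 0) : ∃ i, ∀ x j, f j x ≠ 0 ↔ j = i := by
  obtain ⟨x₀⟩ := ‹Nonempty X›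
  obtain ⟨i, hi, -⟩ := hu x₀
  have hopen : ∀ j, IsOpen {x | f j x ≠ 0} := fun j => isOpen_ne_fun (hf j) continuous_const
  have hcompl : {x | f i x ≠ 0}ᶜ = ⋃ j ∈ {j | j ≠ i}, {x | f j x ≠ 0} := by
    ext x
    simp only [Set.mem_compl_iff, Set.mem_ofPred_eq, Set.mem_iUnion, exists_prop]
    constructor
    · intro hx
      obtain ⟨j, hj, -⟩ := hu x
      exact ⟨j, fun hji => hx (hji ▸ hj), hj⟩
    · rintro ⟨j, hji, hj⟩ hx
      exact hji ((hu x).unique hj hx)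
  have hclopen : IsClopen {x | f i x ≠ 0} :=
    ⟨⟨hcompl ▸ isOpen_biUnion fun j _ => hopen j⟩, hopen i⟩
  have huniv := hclopen.eq_univ ⟨x₀, hi⟩
  have hne : ∀ x, f i x ≠ 0 := fun x => huniv.symm.subset (Set.mem_univ x)
  exact ⟨i, fun x j => ⟨fun hj => (hu x).unique hj (hne x), fun hji => hji ▸ hne x⟩⟩


/-- If `h : ℝⁿ → ℝⁿ` is a C¹ diffeomorphism whose Jacobian matrix is a generalized
permutation matrix (exactly one nonzero entry in each row and each column) at every
point, then there exist a permutation `π` of `{1, …, n}` and C¹ diffeomorphisms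
`T₁, …, Tₙ : ℝ → ℝ` such that `h(ẑ)ₖ = Tₖ(ẑ_{π k})` for all `ẑ` and `k`. -/
theorem generalized_permutation_jacobian_implies_componentwise
    (n : ℕ) (h hinv : (Fin n → ℝ) → (Fin n → ℝ))
    (hh : ContDiff ℝ 1 h) (hhinv : ContDiff ℝ 1 hinv)
    (hli : Function.LeftInverse hinv h) (hri : Function.RightInverse hinv h)
    (H : (Fin n → ℝ) → Matrix (Fin n) (Fin n) ℝ)
    (hH : ∀ (z : Fin n → ℝ) (k i : Fin n),
      H z k i = fderiv ℝ (fun y => h y k) z (Pi.single i 1))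
    (hgp : ∀ z : Fin n → ℝ,
      (∀ k : Fin n, ∃! i : Fin n, H z k i ≠ 0) ∧
      (∀ i : Fin n, ∃! k : Fin n, H z k i ≠ 0)) :
    ∃ (π : Equiv.Perm (Fin n)) (T S : Fin n → ℝ → ℝ),
      (∀ k, ContDiff ℝ 1 (T k) ∧ ContDiff ℝ 1 (S k) ∧
        Function.LeftInverse (S k) (T k) ∧ Function.RightInverse (S k) (T k)) ∧
      ∀ (z : Fin n → ℝ) (k : Fin n), h z k = T k (z (π k)) := by
  have hcoord : ∀ k, ContDiff ℝ 1 fun y => h y k := contDiff_pi.mp hh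
  have hcont : ∀ k i, Continuous fun z => H z k i := by
    intro k i
    simp only [hH]
    exact ((hcoord k).continuous_fderiv one_ne_zero).clm_apply continuous_const
  choose σ hσ using fun k =>
    exists_forall_ne_zero_iff_of_existsUnique (hcont k) fun z => (hgp z).1 k
  have hσinj : Function.Injective σ := fun k l hkl =>
    ((hgp 0).2 (σ k)).unique ((hσ k 0 _).mpr rfl) ((hσ l 0 _).mpr hkl)
  let T : Fin n → ℝ → ℝ := fun k t => h (Pi.single (σ k) t) k
  let S : Fin n → ℝ → ℝ := fun k s => hinv (Pi.single k s) (σ k)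
  have hT : ∀ z k, h z k = T k (z (σ k)) := by
    intro z k
    refine eq_of_partial_fderiv_eq_zero (f := fun y => h y k) (i := σ k)
      ((hcoord k).differentiable one_ne_zero) (fun y j hj => ?_) (by simp)
    rw [← hH]
    exact not_not.mp fun hne => hj ((hσ k y j).mp hne)
  have hTS : ∀ k, Function.RightInverse (S k) (T k) := by
    intro k s
    have := hT (hinv (Pi.single k s)) k
    rw [hri] at this
    simpa using this.symm
  have hTinj : ∀ k, Function.Injective (T k) := by
    intro k a b hab
    refine Pi.single_injective (M := fun _ => ℝ) (σ k) (hli.injective (funext fun l => ?_))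
    rw [hT, hT]
    by_cases hl : l = k
    · subst hl
      simpa using hab
    · have hne : σ l ≠ σ k := hσinj.ne hl
      simp [hne]
  refine ⟨Equiv.ofBijective σ (Finite.injective_iff_bijective.mp hσinj), T, S, fun k =>
    ⟨(hcoord k).comp (contDiff_single _ _ _),
      (contDiff_pi.mp hhinv (σ k)).comp (contDiff_single _ _ _),
      fun t => hTinj k (hTS k _), hTS k⟩, hT⟩
end

section
/- Let n ≥ 1, let h : ℝⁿ → ℝⁿ be a C³ diffeomorphism with Jacobian H, and for each k ∈ {1, …, n} let η_k : ℝ × ℝⁿ → ℝ be three times continuously differentiable. Define η̂(ẑ, z') = ∑_{k=1}^n η_k(h(ẑ)_k, z') + log|det H(ẑ)| and assume: (i) ∂²η̂/∂ẑ_i∂ẑ_j(ẑ, z') = 0 for all ẑ, z' ∈ ℝⁿ and all i ≠ j; and (ii) for every ẑ ∈ ℝⁿ there exist an index l ∈ {1, …, n}, a point w ∈ ℝⁿ, and 2n real numbers c_1, …, c_{2n} such that, writing w^{(r)} for w with its l-th coordinate replaced by c_r, the 2n vectors v_r = ((∂²η_1/∂u∂z'_l)(h(ẑ)_1, w^{(r)}),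 …, (∂²η_n/∂u∂z'_l)(h(ẑ)_n, w^{(r)}), (∂³η_1/∂u²∂z'_l)(h(ẑ)_1, w^{(r)}), …, (∂³η_n/∂u²∂z'_l)(h(ẑ)_n, w^{(r)})) ∈ ℝ^{2n} are linearly independent. Then there exist a permutation π of {1, …, n} and C¹ diffeomorphisms T_1, …, T_n : ℝ → ℝ such that h(ẑ)_k = T_k(ẑ_{π(k)}) for all ẑ and all k. -/
/-- The partial derivative in the first, scalar argument of a `C^(m+1)` function is `C^m`. -/
theorem ContDiff.deriv_fst {E : Type*} [NormedAddCommGroup E] [NormedSpace ℝ E]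
    {m p : WithTop ℕ∞} {f : ℝ × E → ℝ} (hf : ContDiff ℝ p f) (hmp : m + 1 ≤ p) :
    ContDiff ℝ m (fun q : ℝ × E => deriv (fun u => f (u, q.2)) q.1) := by
  have hd : Differentiable ℝ f := (hf.of_le (le_add_self.trans hmp)).differentiable one_ne_zero
  have key : (fun q : ℝ × E => deriv (fun u => f (u, q.2)) q.1)
      = fun q => fderiv ℝ f q (1, 0) := by
    funext q
    have h1 : HasDerivAt (fun u : ℝ => (u, q.2)) ((1 : ℝ), (0 : E)) q.1 :=
      (hasDerivAt_id q.1).prodMk (hasDerivAt_const q.1 q.2)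
    exact ((hd (q.1, q.2)).hasFDerivAt.comp_hasDerivAt q.1 h1).deriv
  rw [key]
  exact (hf.fderiv_right hmp).clm_apply contDiff_const

/-- Iterated directional derivatives of a composition `φ ∘ g` with `φ` a function of one real
variable. -/
theorem fderiv_fderiv_comp_apply {E : Type*} [NormedAddCommGroup E] [NormedSpace ℝ E]
    {φ : ℝ → ℝ} {g : E → ℝ} (hφ : ContDiff ℝ 2 φ) (hg : ContDiff ℝ 2 g) (z a b : E) :
    fderiv ℝ (fun y => fderiv ℝ (fun x => φ (g x)) y a) z b
      = deriv (deriv φ) (g z) * (fderiv ℝ g z a * fderiv ℝ g z b)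
        + deriv φ (g z) * fderiv ℝ (fun y => fderiv ℝ g y a) z b := by
  have hgd : Differentiable ℝ g := hg.differentiable two_ne_zero
  have hφd : Differentiable ℝ φ := hφ.differentiable two_ne_zero
  have hφ' : Differentiable ℝ (deriv φ) :=
    (ContDiff.differentiable (n := 1) (by
      have : ContDiff ℝ (1 + 1) φ := by simpa [one_add_one_eq_two] using hφ
      exact (contDiff_succ_iff_deriv.1 this).2.2) one_ne_zero)
  have hg' : Differentiable ℝ (fun y => fderiv ℝ g y a) :=
    ((hg.fderiv_right (m := 1) (by norm_num [one_add_one_eq_two])).clm_apply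
      contDiff_const).differentiable one_ne_zero
  have h1 : (fun y => fderiv ℝ (fun x => φ (g x)) y a)
      = fun y => deriv φ (g y) * fderiv ℝ g y a := by
    funext y
    have := ((hφd (g y)).hasDerivAt.comp_hasFDerivAt y (hgd y).hasFDerivAt).fderiv
    rw [show (fun x => φ (g x)) = φ ∘ g from rfl, this]
    simp
  have h2 := (((hφ' (g z)).hasDerivAt.comp_hasFDerivAt z (hgd z).hasFDerivAt).mul
    (hg' z).hasFDerivAt).fderiv
  rw [h1]
  have h3 : (fun y => deriv φ (g y) * fderiv ℝ g y a)
    = (deriv φ ∘ g) * (fun y => fderiv ℝ g y a) := rfl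
  rw [h3, h2]
  simp
  ring

/-- A vector orthogonal to as many linearly independent vectors as there are coordinates
vanishes. -/
theorem eq_zero_of_linearIndependent_of_dotProduct_eq_zero {K ι κ : Type*} [Field K]
    [Fintype ι] [Fintype κ] {v : κ → ι → K} (hv : LinearIndependent K v)
    (hcard : Fintype.card κ = Fintype.card ι) {a : ι → K} (ha : ∀ r, v r ⬝ᵥ a = 0) :
    a = 0 := by
  have hspan : Submodule.span K (Set.range v) = ⊤ :=
    hv.span_eq_top_of_card_eq_finrank' (by simpa using hcard)
  refine dotProduct_eq_zero a fun x => ?_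
  have hx : x ∈ Submodule.span K (Set.range v) := hspan ▸ Submodule.mem_top
  induction hx using Submodule.span_induction with
  | mem x hx => obtain ⟨r, rfl⟩ := hx; rw [dotProduct_comm]; exact ha r
  | zero => simp
  | add x y _ _ hx hy => rw [dotProduct_add, hx, hy, add_zero]
  | smul c x _ hx => rw [dotProduct_smul, hx, smul_zero]

/-- The Jacobian matrix of a differentiable map with differentiable left inverse has nonzero
determinant. -/
theorem det_jacobian_ne_zero {n : ℕ} {h hinv : (Fin n → ℝ) → (Fin n → ℝ)}
    (hh : Differentiable ℝ h) (hhinv : Differentiable ℝ hinv) (hli : Function.LeftInverse hinv h)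
    (z : Fin n → ℝ) {A : Matrix (Fin n) (Fin n) ℝ}
    (hA : ∀ k i, A k i = fderiv ℝ (fun y => h y k) z (Pi.single i 1)) : A.det ≠ 0 := by
  have hA' : A = LinearMap.toMatrix' (fderiv ℝ h z : (Fin n → ℝ) →ₗ[ℝ] (Fin n → ℝ)) := by
    ext k i
    rw [hA, LinearMap.toMatrix'_apply, fderiv_apply (hh z)]
    simp
  have hcomp : (fderiv ℝ hinv (h z)).comp (fderiv ℝ h z) = ContinuousLinearMap.id ℝ _ := by
    rw [← fderiv_comp z (hhinv _) (hh z), show hinv ∘ h = id from funext hli, fderiv_id]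
  have hmul : LinearMap.toMatrix' (fderiv ℝ hinv (h z) : (Fin n → ℝ) →ₗ[ℝ] (Fin n → ℝ)) * A
      = 1 := by
    rw [hA', ← LinearMap.toMatrix'_comp, ← ContinuousLinearMap.toLinearMap_comp, hcomp]
    simp
  exact Matrix.det_ne_zero_of_left_inverse hmul

/-- A differentiable function on `ℝⁿ` whose partial derivatives other than the `j`-th all vanish
depends only on the `j`-th coordinate. -/
theorem eq_apply_single_of_fderiv_eq_zero {n : ℕ} {f : (Fin n → ℝ) → ℝ}
    (hf : Differentiable ℝ f) {j : Fin n}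
    (hz : ∀ z i, i ≠ j → fderiv ℝ f z (Pi.single i 1) = 0) (z : Fin n → ℝ) :
    f z = f (Pi.single j (z j)) := by
  set p : Fin n → ℝ := Pi.single j (z j) with hp
  set d : Fin n → ℝ := z - p with hd
  have hdj : d j = 0 := by simp [hd, hp]
  have hzero : ∀ y, fderiv ℝ f y d = 0 := by
    intro y
    rw [pi_eq_sum_univ' d, map_sum]
    refine Finset.sum_eq_zero fun i _ => ?_
    rw [map_smul]
    by_cases hij : i = j
    · rw [hij, hdj, zero_smul]
    · simp [hz y i hij]
  have hline : ∀ t : ℝ, HasDerivAt (fun t : ℝ => f (p + t • d)) 0 t := by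
    intro t
    have h1 : HasDerivAt (fun t : ℝ => p + t • d) d t := by
      simpa using ((hasDerivAt_id t).smul_const d).const_add p
    rw [← hzero (p + t • d)]
    exact (hf (p + t • d)).hasFDerivAt.comp_hasDerivAt t h1
  have := is_const_of_deriv_eq_zero (fun t => (hline t).differentiableAt)
    (fun t => (hline t).deriv) 1 0
  simpa [hd] using this

/-- If at every point of a preconnected space exactly one of finitely many continuous functions
is nonzero, then it is the same one everywhere. -/
theorem exists_forall_ne_zero_iff_eq {X ι : Type*} [TopologicalSpace X] [PreconnectedSpace X]
    [Nonempty X] [Finite ι] {f : ι → X → ℝ} (hf : ∀ i, Continuous (f i))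
    (hne : ∀ x, ∃ i, f i x ≠ 0) (hmul : ∀ x i j, i ≠ j → f i x * f j x = 0) :
    ∃ j, ∀ x i, f i x ≠ 0 ↔ i = j := by
  obtain ⟨x₀⟩ := ‹Nonempty X›
  obtain ⟨j, hj⟩ := hne x₀
  have hopen : ∀ i, IsOpen {x | f i x ≠ 0} := fun i => isOpen_ne_fun (hf i) continuous_const
  have hcompl : {x | f j x ≠ 0}ᶜ = ⋃ i ∈ {i | i ≠ j}, {x | f i x ≠ 0} := by
    ext x
    simp only [Set.mem_compl_iff, Set.mem_ofPred_eq, not_not, Set.mem_iUnion, exists_prop]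
    constructor
    · intro hx
      obtain ⟨i, hi⟩ := hne x
      exact ⟨i, fun hij => hi (hij ▸ hx), hi⟩
    · rintro ⟨i, hij, hi⟩
      exact (mul_eq_zero.1 (hmul x i j hij)).resolve_left hi
  have hclopen : IsClopen {x | f j x ≠ 0} := by
    refine ⟨⟨?_⟩, hopen j⟩
    rw [hcompl]
    exact isOpen_biUnion fun i _ => hopen i
  have huniv := hclopen.eq_univ ⟨x₀, hj⟩
  have hall : ∀ x, f j x ≠ 0 := fun x => by
    have : x ∈ {x | f j x ≠ 0} := huniv ▸ Set.mem_univ x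
    exact this
  refine ⟨j, fun x i => ⟨fun hi => ?_, fun hi => hi ▸ hall x⟩⟩
  by_contra hij
  exact mul_ne_zero hi (hall x) (hmul x i j hij)


/-- Component-wise identifiability (analytic core): let `h : ℝⁿ → ℝⁿ` be a C³
diffeomorphism with Jacobian `H`, let each `ηₖ : ℝ × ℝⁿ → ℝ` be C³, and set
`η̂(ẑ, z') = ∑ₖ ηₖ(h(ẑ)ₖ, z') + log|det H(ẑ)|`. If (i) all mixed partials
`∂²η̂/∂ẑᵢ∂ẑⱼ` (in the `ẑ` variables) vanish for `i ≠ j`, and (ii) at every `ẑ` there are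
an index `l`, a point `w` and `2n` values `c_r` such that the `2n` vectors built from
`(∂²ηₖ/∂u∂z'ₗ)(h(ẑ)ₖ, w⁽ʳ⁾)` and `(∂³ηₖ/∂u²∂z'ₗ)(h(ẑ)ₖ, w⁽ʳ⁾)` are linearly
independent, then there exist a permutation `π` and C¹ diffeomorphisms
`T₁, …, Tₙ : ℝ → ℝ` with `h(ẑ)ₖ = Tₖ(ẑ_{π k})` for all `ẑ` and `k`. -/
theorem componentwise_identifiability
    (n : ℕ) (hn : 1 ≤ n)
    (h hinv : (Fin n → ℝ) → (Fin n → ℝ))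
    (hh : ContDiff ℝ 3 h) (hhinv : ContDiff ℝ 3 hinv)
    (hli : Function.LeftInverse hinv h) (hri : Function.RightInverse hinv h)
    (H : (Fin n → ℝ) → Matrix (Fin n) (Fin n) ℝ)
    (hH : ∀ (z : Fin n → ℝ) (k i : Fin n),
      H z k i = fderiv ℝ (fun y => h y k) z (Pi.single i 1))
    (η : Fin n → ℝ × (Fin n → ℝ) → ℝ) (hη : ∀ k, ContDiff ℝ 3 (η k))
    (ηhat : (Fin n → ℝ) → (Fin n → ℝ) → ℝ)
    (hηhat : ∀ z z', ηhat z z' = ∑ k, η k (h z k, z') + Real.log |(H z).det|)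
    (hcross : ∀ (z z' : Fin n → ℝ) (i j : Fin n), i ≠ j →
      fderiv ℝ (fun y => fderiv ℝ (fun w => ηhat w z') y (Pi.single j 1)) z
        (Pi.single i 1) = 0)
    (hsuff : ∀ z : Fin n → ℝ,
      ∃ (l : Fin n) (w : Fin n → ℝ) (c : Fin (2 * n) → ℝ),
        LinearIndependent ℝ (fun r : Fin (2 * n) =>
          Sum.elim
            (fun k : Fin n =>
              fderiv ℝ (fun v => deriv (fun u => η k (u, v)) (h z k))
                (Function.update w l (c r)) (Pi.single l 1))
            (fun k : Fin n =>
              fderiv ℝ (fun v => deriv (deriv (fun u => η k (u, v))) (h z k))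
                (Function.update w l (c r)) (Pi.single l 1)))) :
    ∃ (π : Equiv.Perm (Fin n)) (T S : Fin n → ℝ → ℝ),
      (∀ k, ContDiff ℝ 1 (T k) ∧ ContDiff ℝ 1 (S k) ∧
        Function.LeftInverse (S k) (T k) ∧ Function.RightInverse (S k) (T k)) ∧
      ∀ (z : Fin n → ℝ) (k : Fin n), h z k = T k (z (π k)) := by
  classical
  have hhd : Differentiable ℝ h := hh.differentiable (by norm_num)
  have hhid : Differentiable ℝ hinv := hhinv.differentiable (by norm_num)
  have hhk : ∀ k, ContDiff ℝ 3 (fun y => h y k) := fun k => contDiff_pi.1 hh k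
  have hdet : ∀ z, (H z).det ≠ 0 := fun z => det_jacobian_ne_zero hhd hhid hli z (hH z)
  have hHsmooth : ∀ k i, ContDiff ℝ 2 (fun z => H z k i) := by
    intro k i
    simp only [hH]
    exact ((hhk k).fderiv_right (by norm_num)).clm_apply contDiff_const
  have hlog : ContDiff ℝ 2 (fun z => Real.log |(H z).det|) := by
    simp only [Real.log_abs]
    refine ContDiff.log ?_ hdet
    simp only [Matrix.det_apply']
    exact ContDiff.sum fun σ _ => contDiff_const.mul (contDiff_prod fun i _ => hHsmooth _ _)
  have hη₁ : ∀ k, ContDiff ℝ 2 (fun q : ℝ × (Fin n → ℝ) => deriv (fun u => η k (u, q.2)) q.1) :=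
    fun k => (hη k).deriv_fst (by norm_num)
  have hη₂ : ∀ k, ContDiff ℝ 1
      (fun q : ℝ × (Fin n → ℝ) => deriv (deriv (fun u => η k (u, q.2))) q.1) :=
    fun k => (hη₁ k).deriv_fst (by norm_num [one_add_one_eq_two])
  have hexpand : ∀ (z : Fin n → ℝ) (i j : Fin n), i ≠ j → ∀ v : Fin n → ℝ,
      ∑ k, (deriv (deriv (fun u => η k (u, v))) (h z k) * (H z k j * H z k i)
        + deriv (fun u => η k (u, v)) (h z k) *
          fderiv ℝ (fun y => fderiv ℝ (fun x => h x k) y (Pi.single j 1)) z (Pi.single i 1))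
      + fderiv ℝ (fun y => fderiv ℝ (fun x => Real.log |(H x).det|) y (Pi.single j 1)) z
          (Pi.single i 1) = 0 := by
    intro z i j hij v
    have hηv : ∀ k, ContDiff ℝ 2 (fun u => η k (u, v)) := fun k =>
      ((hη k).of_le (by norm_num)).comp (contDiff_id.prodMk contDiff_const)
    have hterm : ∀ k, ContDiff ℝ 2 (fun x => η k (h x k, v)) := fun k =>
      (hηv k).comp ((hhk k).of_le (by norm_num))
    have hdir : ∀ f : (Fin n → ℝ) → ℝ, ContDiff ℝ 2 f →
        Differentiable ℝ (fun y => fderiv ℝ f y (Pi.single j 1)) := fun f hf =>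
      ((hf.fderiv_right (m := 1) (by norm_num [one_add_one_eq_two])).clm_apply
        contDiff_const).differentiable one_ne_zero
    have h1 : (fun y => fderiv ℝ (fun w => ηhat w v) y (Pi.single j 1)) = fun y =>
        (∑ k, fderiv ℝ (fun x => η k (h x k, v)) y (Pi.single j 1))
          + fderiv ℝ (fun x => Real.log |(H x).det|) y (Pi.single j 1) := by
      funext y
      simp only [hηhat]
      rw [fderiv_fun_add
        (DifferentiableAt.fun_sum fun k _ => (hterm k).differentiable two_ne_zero y)
        (hlog.differentiable two_ne_zero y),
        fderiv_fun_sum fun k _ => (hterm k).differentiable two_ne_zero y]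
      simp
    have h2 := hcross z v i j hij
    rw [h1, fderiv_fun_add (DifferentiableAt.fun_sum fun k _ => hdir _ (hterm k) z)
      (hdir _ hlog z), fderiv_fun_sum fun k _ => hdir _ (hterm k) z] at h2
    simp only [add_apply, sum_apply] at h2
    rw [← h2]
    congr 1
    refine Finset.sum_congr rfl fun k _ => ?_
    rw [fderiv_fderiv_comp_apply (hηv k) ((hhk k).of_le (by norm_num)), hH, hH]
  have hprod : ∀ (k : Fin n) (z : Fin n → ℝ) (i j : Fin n), i ≠ j →
      H z k i * H z k j = 0 := by
    intro k z i j hij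
    obtain ⟨l, w, c, hind⟩ := hsuff z
    have hzero := eq_zero_of_linearIndependent_of_dotProduct_eq_zero hind
      (by simp [two_mul]) (a := Sum.elim
        (fun k => fderiv ℝ (fun y => fderiv ℝ (fun x => h x k) y (Pi.single j 1)) z
          (Pi.single i 1))
        (fun k => H z k j * H z k i)) (by
        intro r
        have hd₁ : ∀ k, Differentiable ℝ (fun v => deriv (fun u => η k (u, v)) (h z k)) :=
          fun k => ((hη₁ k).comp (contDiff_const.prodMk contDiff_id)).differentiable
            two_ne_zero
        have hd₂ : ∀ k, Differentiable ℝ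
            (fun v => deriv (deriv (fun u => η k (u, v))) (h z k)) :=
          fun k => ((hη₂ k).comp (contDiff_const.prodMk contDiff_id)).differentiable
            one_ne_zero
        have h0 := congrArg (fun f => fderiv ℝ f (Function.update w l (c r)) (Pi.single l 1))
          (funext (hexpand z i j hij))
        simp only [fderiv_add_const] at h0
        rw [fderiv_fun_sum fun k _ =>
          ((hd₂ k _).mul_const _).fun_add ((hd₁ k _).mul_const _)] at h0
        simp only [sum_apply] at h0
        rw [dotProduct, Fintype.sum_sum_type, ← Finset.sum_add_distrib]
        simp only [Sum.elim_inl, Sum.elim_inr]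
        refine Eq.trans (Finset.sum_congr rfl fun k _ => ?_) (h0.trans (by simp))
        rw [fderiv_fun_add ((hd₂ k _).mul_const _) ((hd₁ k _).mul_const _),
          fderiv_mul_const (hd₂ k _), fderiv_mul_const (hd₁ k _)]
        simp
        ring)
    have := congrFun hzero (Sum.inr k)
    rw [mul_comm]
    simpa using this
  have hsupp : ∀ k, ∃ j, ∀ z i, H z k i ≠ 0 ↔ i = j := fun k =>
    exists_forall_ne_zero_iff_eq (f := fun i z => H z k i) (fun i => (hHsmooth k i).continuous)
      (fun z => by
        by_contra! hrow
        exact hdet z (Matrix.det_eq_zero_of_row_eq_zero k hrow))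
      (hprod k)
  choose p hp using hsupp
  have hsurj : Function.Surjective p := by
    intro i
    by_contra! hi
    refine hdet 0 (Matrix.det_eq_zero_of_column_eq_zero i fun k => ?_)
    by_contra hne
    exact hi k ((hp k 0 i).1 hne).symm
  have hbij : Function.Bijective p := Finite.surjective_iff_bijective.1 hsurj
  have hcomp : ∀ z k, h z k = h (Pi.single (p k) (z (p k))) k := fun z k =>
    eq_apply_single_of_fderiv_eq_zero (f := fun y => h y k)
      ((hhk k).differentiable (by norm_num))
      (fun y i hi => by
        rw [← hH]
        by_contra hne
        exact hi ((hp k y i).1 hne)) z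
  have hsingle : ∀ m : Fin n, ContDiff ℝ 1 (fun t : ℝ => (Pi.single m t : Fin n → ℝ)) :=
    fun m => contDiff_single (𝕜 := ℝ) (F' := fun _ : Fin n => ℝ) 1 m
  have hright : ∀ k (s : ℝ),
      h (Pi.single (p k) (hinv (Pi.single k s) (p k))) k = s := fun k s => by
    rw [← hcomp, hri]
    simp
  have hinj : ∀ k, Function.Injective (fun t : ℝ => h (Pi.single (p k) t) k) := by
    intro k t t' htt
    have heq : h (Pi.single (p k) t) = h (Pi.single (p k) t') := by
      funext j
      by_cases hjk : j = k
      · rw [hjk]; exact htt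
      · have hne : p j ≠ p k := fun e => hjk (hbij.1 e)
        rw [hcomp _ j, hcomp (Pi.single (p k) t') j]
        simp [hne]
    exact Pi.single_injective _ (hli.injective heq)
  refine ⟨Equiv.ofBijective p hbij, fun k t => h (Pi.single (p k) t) k,
    fun k s => hinv (Pi.single k s) (p k), fun k => ⟨?_, ?_, fun t => hinj k (hright k _),
      hright k⟩, hcomp⟩
  · exact ((hhk k).of_le (by norm_num)).comp (hsingle (p k))
  · exact ((contDiff_pi.1 hhinv (p k)).of_le (by norm_num)).comp (hsingle k)
end
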